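/- Let C₁ = K(x₁, r₁), C₂ = K(x₂, r₂), C₃ = K(x₃, r₃) be circles with rᵢ > 0 that are pairwise externally disjoint: ‖xᵢ − xⱼ‖ > rᵢ + rⱼ for all i ≠ j. Then the Apollonius problem for (C₁, C₂, C₃) has exactly 8 solutions. -/

import Mathlib

open RealInnerProductSpace

noncomputable section

/-- The Euclidean plane. -/
abbrev Pl := EuclideanSpace ℝ (Fin 2)

/-- The circle of center `x` and radius `r` in the Euclidean plane. -/
def K (x : Pl) (r : ℝ) : Set Pl := {p | dist p x = r}

/-- Two circles, given by centers and (positive) radii, are tangent. -/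
def CircleTangent (y : Pl) (s : ℝ) (x : Pl) (r : ℝ) : Prop :=
  dist y x = s + r ∨ dist y x = |s - r|

/-- A line (a 1-dimensional affine subspace of the plane) is tangent to a circle iff it
meets it in exactly one point. -/
def LineTangent (L : AffineSubspace ℝ Pl) (x : Pl) (r : ℝ) : Prop :=
  ∃! p, p ∈ (L : Set Pl) ∩ K x r

/-- Solutions of the Apollonius problem for three circles with centers `x i` and radii
`r i`: a solution is either a circle `(y, s)` with `s > 0` tangent to all three, or a
line (1-dimensional affine subspace) tangent to all three, or a point lying on all
three. The solution set is the disjoint union (sum type) of these three sets. -/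
def ApolloniusSolutions (x : Fin 3 → Pl) (r : Fin 3 → ℝ) : Type :=
  {ys : Pl × ℝ // 0 < ys.2 ∧ ∀ i, CircleTangent ys.1 ys.2 (x i) (r i)} ⊕
  {L : AffineSubspace ℝ Pl // Module.finrank ℝ L.direction = 1 ∧
    ∀ i, LineTangent L (x i) (r i)} ⊕
  {p : Pl // ∀ i, p ∈ K (x i) (r i)}



/-- sign -/
def sg (b : Bool) : ℝ := if b then 1 else -1

lemma sg_sq (b : Bool) : sg b ^ 2 = 1 := by cases b <;> simp [sg]

lemma sg_inj {a b : Bool} (h : sg a = sg b) : a = b := by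
  cases a <;> cases b <;> simp [sg] at * <;> norm_num at h

lemma exists_sg {w r : ℝ} (h : w ^ 2 = r ^ 2) : ∃ b, w = sg b * r := by
  rcases sq_eq_sq_iff_eq_or_eq_neg.mp h with h | h
  · exact ⟨true, by simp [sg, h]⟩
  · exact ⟨false, by simp [sg, h]⟩

lemma dsq (p x : Pl) : dist p x ^ 2 = (p 0 - x 0) ^ 2 + (p 1 - x 1) ^ 2 := by
  rw [EuclideanSpace.dist_eq, Real.sq_sqrt (by positivity)]
  simp [Fin.sum_univ_two, Real.dist_eq, sq_abs]

lemma dist_iff (p x : Pl) {r : ℝ} (hr : 0 ≤ r) :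
    dist p x = r ↔ (p 0 - x 0) ^ 2 + (p 1 - x 1) ^ 2 = r ^ 2 := by
  rw [← dsq]
  exact ⟨fun h => by rw [h], fun h => by
    exact (sq_eq_sq₀ dist_nonneg hr).mp h⟩

lemma card_two (a b v : ℝ) (h : v ^ 2 < a ^ 2 + b ^ 2) :
    Nat.card {u : ℝ × ℝ // u.1 ^ 2 + u.2 ^ 2 = 1 ∧ a * u.1 + b * u.2 + v = 0} = 2 := by
  obtain ⟨w, hw, hw2⟩ : ∃ w : ℝ, 0 < w ∧ w ^ 2 = a ^ 2 + b ^ 2 - v ^ 2 :=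
    ⟨√(a ^ 2 + b ^ 2 - v ^ 2), Real.sqrt_pos.mpr (by linarith), Real.sq_sqrt (by linarith)⟩
  obtain ⟨D, hD⟩ : ∃ D, D = a ^ 2 + b ^ 2 := ⟨_, rfl⟩
  have hD0 : 0 < D := by rw [hD]; nlinarith [sq_nonneg v]
  have hD1 : D ≠ 0 := hD0.ne'
  have key : {u : ℝ × ℝ | u.1 ^ 2 + u.2 ^ 2 = 1 ∧ a * u.1 + b * u.2 + v = 0} =
      {((-v * a - b * w) / D, (-v * b + a * w) / D),
        ((-v * a + b * w) / D, (-v * b - a * w) / D)} := by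
    ext ⟨s, t⟩
    simp only [Set.mem_ofPred_eq, Set.mem_insert_iff, Set.mem_singleton_iff, Prod.mk.injEq]
    constructor
    · rintro ⟨h1, h2⟩
      have h3 : (a * t - b * s) ^ 2 = w ^ 2 := by
        rw [hw2]
        have : v = -(a * s + b * t) := by linarith
        rw [this]
        linear_combination (a ^ 2 + b ^ 2) * h1
      rcases sq_eq_sq_iff_eq_or_eq_neg.mp h3 with h4 | h4
      · left
        constructor
        · rw [eq_div_iff hD1, hD]; linear_combination a * h2 - b * h4
        · rw [eq_div_iff hD1, hD]; linear_combination b * h2 + a * h4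
      · right
        constructor
        · rw [eq_div_iff hD1, hD]; linear_combination a * h2 - b * h4
        · rw [eq_div_iff hD1, hD]; linear_combination b * h2 + a * h4
    · rintro (⟨rfl, rfl⟩ | ⟨rfl, rfl⟩)
      · constructor
        · field_simp
          rw [hD]
          linear_combination (a ^ 2 + b ^ 2) * hw2
        · field_simp
          rw [hD]; ring
      · constructor
        · field_simp
          rw [hD]
          linear_combination (a ^ 2 + b ^ 2) * hw2
        · field_simp
          rw [hD]; ring
  have : Nat.card {u : ℝ × ℝ // u.1 ^ 2 + u.2 ^ 2 = 1 ∧ a * u.1 + b * u.2 + v = 0} =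
    Set.ncard {u : ℝ × ℝ | u.1 ^ 2 + u.2 ^ 2 = 1 ∧ a * u.1 + b * u.2 + v = 0} := rfl
  rw [this, key]
  apply Set.ncard_pair
  intro h
  simp only [Prod.mk.injEq] at h
  obtain ⟨ha, hb⟩ := h
  rw [div_left_inj' hD1] at ha hb
  have hb' : b = 0 := by
    have : b * w = 0 := by linarith
    rcases mul_eq_zero.mp this with h | h
    · exact h
    · exact absurd h hw.ne'
  have ha' : a = 0 := by
    have : a * w = 0 := by linarith
    rcases mul_eq_zero.mp this with h | h
    · exact h
    · exact absurd h hw.ne'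
  rw [ha', hb'] at hD
  apply hD1
  rw [hD]; ring

/-- admissible directions -/
def Good (p q : ℝ × ℝ) (σ τ : ℝ) (u : ℝ × ℝ) : Prop :=
  u.1 ^ 2 + u.2 ^ 2 = 1 ∧
    (q.1 ^ 2 + q.2 ^ 2 - τ ^ 2) * (u.1 * p.1 + u.2 * p.2 + σ) =
    (p.1 ^ 2 + p.2 ^ 2 - σ ^ 2) * (u.1 * q.1 + u.2 * q.2 + τ)

lemma card_good (p q : ℝ × ℝ) (σ τ : ℝ) (h1 : σ ^ 2 < p.1 ^ 2 + p.2 ^ 2)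
    (h2 : τ ^ 2 < q.1 ^ 2 + q.2 ^ 2)
    (h3 : (σ - τ) ^ 2 < (p.1 - q.1) ^ 2 + (p.2 - q.2) ^ 2) :
    Nat.card {u // Good p q σ τ u} = 2 := by
  set k := p.1 ^ 2 + p.2 ^ 2 - σ ^ 2 with hk
  set l := q.1 ^ 2 + q.2 ^ 2 - τ ^ 2 with hl
  rw [← card_two (l * p.1 - k * q.1) (l * p.2 - k * q.2) (l * σ - k * τ)]
  · apply Nat.card_congr
    apply Equiv.subtypeEquivRight
    intro u
    unfold Good
    rw [← hk, ← hl]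
    constructor
    · rintro ⟨h, h'⟩
      exact ⟨h, by linear_combination h'⟩
    · rintro ⟨h, h'⟩
      exact ⟨h, by linear_combination h'⟩
  · have : 0 < k * l * ((p.1 - q.1) ^ 2 + (p.2 - q.2) ^ 2 - (σ - τ) ^ 2) :=
      mul_pos (mul_pos (by linarith) (by linarith)) (by linarith)
    rw [← sub_pos]
    refine this.trans_eq ?_
    rw [hk, hl]; ring

lemma card_rel {A B : Type*} (R : A → B → Prop) (h1 : ∀ a, ∃! b, R a b)
    (h2 : ∀ b, ∃! a, R a b) : Nat.card A = Nat.card B := by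
  choose f hf hf' using h1
  refine Nat.card_eq_of_bijective f ⟨?_, ?_⟩
  · intro a a' h
    exact (h2 (f a)).unique (hf a) (h ▸ hf a')
  · intro b
    obtain ⟨a, ha, -⟩ := h2 b
    exact ⟨a, (hf' a b ha).symm⟩

/-- `L` is the line `u·p = c`. -/
def IsLn (L : AffineSubspace ℝ Pl) (u : ℝ × ℝ) (c : ℝ) : Prop :=
  ∀ p : Pl, p ∈ L ↔ u.1 * p 0 + u.2 * p 1 = c

lemma lineTangent_iff {L : AffineSubspace ℝ Pl} {u : ℝ × ℝ} {c : ℝ} (hL : IsLn L u c)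
    (hu : u.1 ^ 2 + u.2 ^ 2 = 1) (x : Pl) {r : ℝ} (hr : 0 ≤ r) :
    LineTangent L x r ↔ (c - (u.1 * x 0 + u.2 * x 1)) ^ 2 = r ^ 2 := by
  obtain ⟨m, hm⟩ : ∃ m, m = c - (u.1 * x 0 + u.2 * x 1) := ⟨_, rfl⟩
  rw [← hm]
  have hmem : ∀ p : Pl, p ∈ (L : Set Pl) ∩ K x r ↔ u.1 * p 0 + u.2 * p 1 = c ∧
      (p 0 - x 0) ^ 2 + (p 1 - x 1) ^ 2 = r ^ 2 := by
    intro p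
    rw [Set.mem_inter_iff, SetLike.mem_coe, hL p]
    unfold K
    rw [Set.mem_ofPred_eq, dist_iff p x hr]
  unfold LineTangent
  simp only [hmem]
  constructor
  · rintro ⟨p, ⟨h1, h2⟩, h3⟩
    have h4 := h3 (!₂[2 * (x 0 + m * u.1) - p 0, 2 * (x 1 + m * u.2) - p 1]) (by
      simp only [Matrix.cons_val_zero, Matrix.cons_val_one]
      constructor
      · linear_combination 2 * m * hu + 2 * hm - h1
      · linear_combination h2 + 4 * m ^ 2 * hu - 4 * m * h1 + 4 * m * hm)
    have h5 := congrArg (fun v : Pl => v 0) h4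
    have h6 := congrArg (fun v : Pl => v 1) h4
    simp only [Matrix.cons_val_zero, Matrix.cons_val_one] at h5 h6
    have e0 : p 0 - x 0 = m * u.1 := by linarith
    have e1 : p 1 - x 1 = m * u.2 := by linarith
    rw [e0, e1] at h2
    linear_combination h2 - m ^ 2 * hu
  · intro h
    refine ⟨!₂[x 0 + m * u.1, x 1 + m * u.2], ?_, ?_⟩
    · simp only [Matrix.cons_val_zero, Matrix.cons_val_one]
      constructor
      · linear_combination m * hu + hm
      · linear_combination m ^ 2 * hu + h
    · rintro p ⟨h1, h2⟩
      have h3 : (p 0 - x 0 - m * u.1) ^ 2 + (p 1 - x 1 - m * u.2) ^ 2 = 0 := by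
        linear_combination h2 + m ^ 2 * hu - 2 * m * h1 - h + 2 * m * hm
      have e0 : p 0 - x 0 - m * u.1 = 0 := by nlinarith [sq_nonneg (p 0 - x 0 - m * u.1), sq_nonneg (p 1 - x 1 - m * u.2)]
      have e1 : p 1 - x 1 - m * u.2 = 0 := by nlinarith [sq_nonneg (p 0 - x 0 - m * u.1), sq_nonneg (p 1 - x 1 - m * u.2)]
      ext i
      fin_cases i
      · simp; linarith
      · simp; linarith

lemma exists_line (u : ℝ × ℝ) (hu : u.1 ^ 2 + u.2 ^ 2 = 1) (c : ℝ) :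
    ∃ L : AffineSubspace ℝ Pl, Module.finrank ℝ L.direction = 1 ∧ IsLn L u c := by
  refine ⟨AffineSubspace.mk' (!₂[c * u.1, c * u.2] : Pl) (Submodule.span ℝ {(!₂[-u.2, u.1] : Pl)}), ?_, ?_⟩
  · rw [AffineSubspace.direction_mk', finrank_span_singleton]
    intro h
    have h5 := congrArg (fun v : Pl => v 0) h
    have h6 := congrArg (fun v : Pl => v 1) h
    simp at h5 h6
    rw [h5, h6] at hu
    norm_num at hu
  · intro p
    rw [AffineSubspace.mem_mk', Submodule.mem_span_singleton]
    constructor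
    · rintro ⟨a, ha⟩
      have h5 := congrArg (fun v : Pl => v 0) ha
      have h6 := congrArg (fun v : Pl => v 1) ha
      simp at h5 h6
      linear_combination -u.1 * h5 - u.2 * h6 + c * hu
    · intro h
      refine ⟨u.1 * p 1 - u.2 * p 0, ?_⟩
      ext i
      fin_cases i
      · simp
        linear_combination -u.1 * h + p 0 * hu
      · simp
        linear_combination -u.2 * h + p 1 * hu

lemma line_rep (L : AffineSubspace ℝ Pl) (h : Module.finrank ℝ L.direction = 1)
    {p₀ : Pl} (hp : p₀ ∈ L) : ∃ u : ℝ × ℝ, u.1 ^ 2 + u.2 ^ 2 = 1 ∧ ∃ c, IsLn L u c := by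
  obtain ⟨⟨v, hv⟩, hv0, hspan⟩ := finrank_eq_one_iff'.mp h
  have hv0' : v ≠ 0 := fun h => hv0 (by ext1; exact h)
  have hpos : 0 < v 0 ^ 2 + v 1 ^ 2 := by
    by_contra hc
    apply hv0'
    have e0 : v 0 = 0 := by nlinarith [sq_nonneg (v 0), sq_nonneg (v 1)]
    have e1 : v 1 = 0 := by nlinarith [sq_nonneg (v 0), sq_nonneg (v 1)]
    ext i
    fin_cases i
    · simpa using e0
    · simpa using e1
  obtain ⟨w, hw, hw2⟩ : ∃ w : ℝ, 0 < w ∧ w ^ 2 = v 0 ^ 2 + v 1 ^ 2 :=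
    ⟨√(v 0 ^ 2 + v 1 ^ 2), Real.sqrt_pos.mpr hpos, Real.sq_sqrt hpos.le⟩
  refine ⟨(-v 1 / w, v 0 / w), ?_, (-v 1 / w) * p₀ 0 + (v 0 / w) * p₀ 1, ?_⟩
  · simp only
    field_simp
    linarith
  · intro p
    simp only
    have hmem : p ∈ L ↔ p - p₀ ∈ L.direction := by
      rw [← vsub_eq_sub, AffineSubspace.vsub_right_mem_direction_iff_mem hp]
    rw [hmem]
    constructor
    · intro hd
      obtain ⟨a, ha⟩ := hspan ⟨_, hd⟩
      have ha' : a • v = p - p₀ := congrArg Subtype.val ha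
      have h5 := congrArg (fun v : Pl => v 0) ha'
      have h6 := congrArg (fun v : Pl => v 1) ha'
      simp at h5 h6
      field_simp
      linear_combination v 1 * h5 - v 0 * h6
    · intro he
      field_simp at he
      have : p - p₀ = ((v 0 * (p 0 - p₀ 0) + v 1 * (p 1 - p₀ 1)) / (v 0 ^ 2 + v 1 ^ 2)) • v := by
        ext i
        fin_cases i
        · simp
          field_simp
          linear_combination -v 1 * he
        · simp
          field_simp
          linear_combination v 0 * he
      rw [this]
      exact Submodule.smul_mem _ _ hv

lemma circleTangent_iff (y x : Pl) {s r : ℝ} (hs : 0 < s) (hr : 0 < r) :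
    CircleTangent y s x r ↔ ∃ b, (y 0 - x 0) ^ 2 + (y 1 - x 1) ^ 2 = (s + sg b * r) ^ 2 := by
  unfold CircleTangent
  rw [dist_iff y x (by positivity), dist_iff y x (abs_nonneg _), sq_abs]
  simp [sg, Bool.exists_bool, or_comm, sub_eq_add_neg]

/-- no common point -/
lemma no_common {D w r₁ r₂ : ℝ} (h₁ : 0 < r₁) (h₂ : 0 < r₂) (hD : (r₁ + r₂) ^ 2 < D)
    (hw : w ^ 2 ≤ D) (h : D = 2 * r₁ * w + r₂ ^ 2 - r₁ ^ 2) : False := by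
  have : w ≤ r₁ + r₂ := by
    have : (w - r₁) ^ 2 ≤ r₂ ^ 2 := by nlinarith
    have := abs_le_of_sq_le_sq' this h₂.le
    linarith [this.2]
  nlinarith

lemma exists_sg_mul (a b : Bool) : ∃ c, sg c = sg a * sg b := by
  cases a <;> cases b <;> simp [sg, Bool.exists_bool]

/-- the relation for circles -/
def RC (x : Pl) (r : ℝ) (p q : ℝ × ℝ) (σ τ : ℝ) (u : ℝ × ℝ) (y : Pl) (s : ℝ) : Prop :=
  ∃ t, |t| = s ∧ y 0 = x 0 + (t + r) * u.1 ∧ y 1 = x 1 + (t + r) * u.2 ∧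
    2 * (t + r) * (u.1 * p.1 + u.2 * p.2 + σ) = p.1 ^ 2 + p.2 ^ 2 - σ ^ 2 ∧
    2 * (t + r) * (u.1 * q.1 + u.2 * q.2 + τ) = q.1 ^ 2 + q.2 ^ 2 - τ ^ 2

/-- the relation for lines -/
def RL (x : Pl) (r : ℝ) (p q : ℝ × ℝ) (σ τ : ℝ) (u : ℝ × ℝ) (L : AffineSubspace ℝ Pl) : Prop :=
  IsLn L u (u.1 * x 0 + u.2 * x 1 + r) ∧ u.1 * p.1 + u.2 * p.2 + σ = 0 ∧
    u.1 * q.1 + u.2 * q.2 + τ = 0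

lemma far {x y : Pl} {r s : ℝ} (hr : 0 < r) (hs : 0 < s) (h : ‖x - y‖ > r + s) :
    (r + s) ^ 2 < (y 0 - x 0) ^ 2 + (y 1 - x 1) ^ 2 := by
  rw [← dsq, dist_comm, dist_eq_norm]
  exact pow_lt_pow_left₀ h (by positivity) (by norm_num)

lemma sg_bd (a : Bool) {r s : ℝ} (hr : 0 < r) (hs : 0 < s) :
    (sg a * s - r) ^ 2 ≤ (r + s) ^ 2 := by
  have := mul_pos hr hs
  cases a <;> simp [sg] <;> nlinarith

lemma sg_bd2 (a b : Bool) {r s : ℝ} (hr : 0 < r) (hs : 0 < s) :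
    (sg a * r - sg b * s) ^ 2 ≤ (r + s) ^ 2 := by
  have := mul_pos hr hs
  cases a <;> cases b <;> simp [sg] <;> nlinarith

lemma sg_cancel {t r : ℝ} {a b : Bool} (ht : t ≠ 0) (hr : r ≠ 0)
    (h : (sg a * r + t) ^ 2 = (sg b * r + t) ^ 2) : a = b := by
  apply sg_inj
  have h1 : (2 * t * r) * (sg a - sg b) = 0 := by
    linear_combination h - r ^ 2 * sg_sq a + r ^ 2 * sg_sq b
  have h2 : 2 * t * r ≠ 0 := by positivity
  have := (mul_eq_zero.mp h1).resolve_left h2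
  linarith

lemma sumsq_zero {a b c d : ℝ} (h : (a - b) ^ 2 + (c - d) ^ 2 = 0) : a = b ∧ c = d := by
  constructor <;> nlinarith [sq_nonneg (a - b), sq_nonneg (c - d)]

set_option maxHeartbeats 2000000 in
lemma main_aux (x₁ x₂ x₃ : Pl) (r₁ r₂ r₃ : ℝ)
    (h₁ : 0 < r₁) (h₂ : 0 < r₂) (h₃ : 0 < r₃) (p q : ℝ × ℝ)
    (hp1 : p.1 = x₂ 0 - x₁ 0) (hp2 : p.2 = x₂ 1 - x₁ 1)
    (hq1 : q.1 = x₃ 0 - x₁ 0) (hq2 : q.2 = x₃ 1 - x₁ 1)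
    (hp : (r₁ + r₂) ^ 2 < p.1 ^ 2 + p.2 ^ 2)
    (hq : (r₁ + r₃) ^ 2 < q.1 ^ 2 + q.2 ^ 2) :
    Nat.card (ApolloniusSolutions ![x₁, x₂, x₃] ![r₁, r₂, r₃]) =
    Nat.card (Σ e : Bool × Bool, {u // Good p q (sg e.1 * r₂ - r₁) (sg e.2 * r₃ - r₁) u}) := by
  unfold ApolloniusSolutions
  refine card_rel (Sum.elim
    (fun a b => RC x₁ r₁ p q (sg b.1.1 * r₂ - r₁) (sg b.1.2 * r₃ - r₁) b.2.1 a.1.1 a.1.2)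
    (Sum.elim
      (fun a b => RL x₁ r₁ p q (sg b.1.1 * r₂ - r₁) (sg b.1.2 * r₃ - r₁) b.2.1 a.1)
      (fun _ _ => False))) ?_ ?_
  · rintro (⟨⟨y, s⟩, hs, hT⟩ | ⟨L, hL, hT⟩ | ⟨z, hz⟩)
    · simp only [Sum.elim_inl]
      simp only at hs hT
      refine existsUnique_of_exists_of_unique ?_ ?_
      · obtain ⟨b, hb⟩ := (circleTangent_iff y x₁ hs h₁).mp (hT 0)
        obtain ⟨b₂, hb₂⟩ := (circleTangent_iff y x₂ hs h₂).mp (hT 1)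
        obtain ⟨b₃, hb₃⟩ := (circleTangent_iff y x₃ hs h₃).mp (hT 2)
        obtain ⟨c₂, hc₂⟩ := exists_sg_mul b b₂
        obtain ⟨c₃, hc₃⟩ := exists_sg_mul b b₃
        obtain ⟨t, ht⟩ : ∃ t, t = sg b * s := ⟨_, rfl⟩
        have hbb := sg_sq b
        have e1 : (y 0 - x₁ 0) ^ 2 + (y 1 - x₁ 1) ^ 2 = (t + r₁) ^ 2 := by
          rw [hb, ht]; linear_combination (r₁ ^ 2 - s ^ 2) * hbb
        have e2 : (y 0 - x₂ 0) ^ 2 + (y 1 - x₂ 1) ^ 2 = (t + sg c₂ * r₂) ^ 2 := by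
          rw [hb₂, ht, hc₂]; linear_combination -(s + sg b₂ * r₂) ^ 2 * hbb
        have e3 : (y 0 - x₃ 0) ^ 2 + (y 1 - x₃ 1) ^ 2 = (t + sg c₃ * r₃) ^ 2 := by
          rw [hb₃, ht, hc₃]; linear_combination -(s + sg b₃ * r₃) ^ 2 * hbb
        have hτ : t + r₁ ≠ 0 := by
          intro h0
          rw [h0] at e1
          obtain ⟨f0, f1⟩ := sumsq_zero (e1.trans (by norm_num))
          have := sg_bd c₂ h₁ h₂
          rw [f0, f1, show t = -r₁ by linarith] at e2
          rw [hp1, hp2] at hp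
          have e2' : (x₂ 0 - x₁ 0) ^ 2 + (x₂ 1 - x₁ 1) ^ 2 = (sg c₂ * r₂ - r₁) ^ 2 := by
            linear_combination e2
          linarith
        obtain ⟨u0, hu0⟩ : ∃ u0, u0 = (y 0 - x₁ 0) / (t + r₁) := ⟨_, rfl⟩
        obtain ⟨u1, hu1⟩ : ∃ u1, u1 = (y 1 - x₁ 1) / (t + r₁) := ⟨_, rfl⟩
        rw [eq_div_iff hτ] at hu0 hu1
        have g0 : y 0 = x₁ 0 + (t + r₁) * u0 := by linarith
        have g1 : y 1 = x₁ 1 + (t + r₁) * u1 := by linarith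
        have hu : u0 ^ 2 + u1 ^ 2 = 1 := by
          have h : (t + r₁) ^ 2 ≠ 0 := pow_ne_zero 2 hτ
          apply mul_left_cancel₀ h
          rw [g0, g1] at e1
          linear_combination e1
        have k2 : 2 * (t + r₁) * (u0 * p.1 + u1 * p.2 + (sg c₂ * r₂ - r₁)) =
            p.1 ^ 2 + p.2 ^ 2 - (sg c₂ * r₂ - r₁) ^ 2 := by
          rw [g0, g1] at e1 e2
          rw [hp1, hp2]
          linear_combination e1 - e2
        have k3 : 2 * (t + r₁) * (u0 * q.1 + u1 * q.2 + (sg c₃ * r₃ - r₁)) =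
            q.1 ^ 2 + q.2 ^ 2 - (sg c₃ * r₃ - r₁) ^ 2 := by
          rw [g0, g1] at e1 e3
          rw [hq1, hq2]
          linear_combination e1 - e3
        refine ⟨⟨(c₂, c₃), ⟨(u0, u1), hu, ?_⟩⟩, t, ?_, g0, g1, k2, k3⟩
        · simp only
          rw [← k2, ← k3]; ring
        · rw [ht, abs_mul, abs_of_pos hs]
          cases b <;> simp [sg]
      · rintro ⟨⟨a, a'⟩, ⟨⟨u0, u1⟩, hu, hG⟩⟩ ⟨⟨b, b'⟩, ⟨⟨v0, v1⟩, hv, hG'⟩⟩ ⟨t, ht, e1, e2, e3, e4⟩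
          ⟨t', ht', f1, f2, f3, f4⟩
        simp only at *
        have htt : t' = t := by
          have : (t + r₁) ^ 2 = (t' + r₁) ^ 2 := by
            have i1 : (y 0 - x₁ 0) ^ 2 + (y 1 - x₁ 1) ^ 2 = (t + r₁) ^ 2 := by
              rw [e1, e2]; linear_combination (t + r₁) ^ 2 * hu
            have i2 : (y 0 - x₁ 0) ^ 2 + (y 1 - x₁ 1) ^ 2 = (t' + r₁) ^ 2 := by
              rw [f1, f2]; linear_combination (t' + r₁) ^ 2 * hv
            rw [← i1, i2]
          have h' : t ^ 2 = t' ^ 2 := by rw [← sq_abs t, ← sq_abs t', ht, ht']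
          have : 2 * r₁ * (t' - t) = 0 := by linear_combination h' - this
          have := (mul_eq_zero.mp this).resolve_left (by positivity)
          linarith
        subst htt
        have ht0 : t' ≠ 0 := by
          intro h; rw [h, abs_zero] at ht; linarith
        have hτ : t' + r₁ ≠ 0 := by
          intro h0
          rw [h0] at e3
          have := sg_bd a h₁ h₂
          linarith
        have q0 : u0 = v0 := mul_left_cancel₀ hτ (by linarith)
        have q1 : u1 = v1 := mul_left_cancel₀ hτ (by linarith)
        subst q0 q1
        have z1 : a = b := sg_cancel ht0 h₂.ne' (by linear_combination e3 - f3)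
        have z2 : a' = b' := sg_cancel ht0 h₃.ne' (by linear_combination e4 - f4)
        subst z1 z2
        rfl
    · simp only [Sum.elim_inl, Sum.elim_inr]
      refine existsUnique_of_exists_of_unique ?_ ?_
      · obtain ⟨p₀, ⟨hp₀, -⟩, -⟩ := hT 0
        obtain ⟨u, hu, c, hc⟩ := line_rep L hL hp₀
        obtain ⟨b, hb⟩ := exists_sg ((lineTangent_iff hc hu x₁ h₁.le).mp (hT 0))
        have hbb := sg_sq b
        obtain ⟨b₂, hb₂⟩ := exists_sg ((lineTangent_iff hc hu x₂ h₂.le).mp (hT 1))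
        obtain ⟨b₃, hb₃⟩ := exists_sg ((lineTangent_iff hc hu x₃ h₃.le).mp (hT 2))
        obtain ⟨c₂, hc₂⟩ := exists_sg_mul b b₂
        obtain ⟨c₃, hc₃⟩ := exists_sg_mul b b₃
        have k2 : sg b * u.1 * p.1 + sg b * u.2 * p.2 + (sg c₂ * r₂ - r₁) = 0 := by
          rw [hp1, hp2, hc₂]
          linear_combination sg b * hb - sg b * hb₂ + r₁ * hbb
        have k3 : sg b * u.1 * q.1 + sg b * u.2 * q.2 + (sg c₃ * r₃ - r₁) = 0 := by
          rw [hq1, hq2, hc₃]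
          linear_combination sg b * hb - sg b * hb₃ + r₁ * hbb
        refine ⟨⟨(c₂, c₃), ⟨(sg b * u.1, sg b * u.2), ?_, ?_⟩⟩, ?_, k2, k3⟩
        · simp only
          linear_combination sg b ^ 2 * hu + hbb
        · simp only
          rw [k2, k3]; ring
        · intro z
          rw [hc z]
          simp only
          constructor
          · intro h
            linear_combination sg b * h + sg b * hb + r₁ * hbb
          · intro h
            linear_combination sg b * h + (u.1 * x₁ 0 + u.2 * x₁ 1 - u.1 * z 0 - u.2 * z 1) * hbb - hb
      · rintro ⟨⟨a, a'⟩, ⟨⟨u0, u1⟩, hu, hG⟩⟩ ⟨⟨b, b'⟩, ⟨⟨v0, v1⟩, hv, hG'⟩⟩ ⟨e1, e2, e3⟩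
          ⟨f1, f2, f3⟩
        simp only at *
        have m1 := (f1 !₂[x₁ 0 + r₁ * u0, x₁ 1 + r₁ * u1]).mp ((e1 _).mpr (by
          simp
          linear_combination r₁ * hu))
        simp at m1
        have m2 : u0 * v0 + u1 * v1 = 1 := by
          apply mul_left_cancel₀ h₁.ne'
          linear_combination m1
        have m3 : (u0 - v0) ^ 2 + (u1 - v1) ^ 2 = 0 := by
          linear_combination hu + hv - 2 * m2
        obtain ⟨q0, q1⟩ := sumsq_zero m3
        subst q0 q1
        have z1 : a = b := sg_inj (mul_right_cancel₀ h₂.ne' (by linarith))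
        have z2 : a' = b' := sg_inj (mul_right_cancel₀ h₃.ne' (by linarith))
        subst z1 z2
        rfl
    · exfalso
      have g1 := (dist_iff z x₁ h₁.le).mp (hz 0)
      have g2 := (dist_iff z x₂ h₂.le).mp (hz 1)
      have hr : r₁ ≠ 0 := h₁.ne'
      refine no_common h₁ h₂ hp
        (w := ((z 0 - x₁ 0) * p.1 + (z 1 - x₁ 1) * p.2) / r₁) ?_ ?_
      · rw [div_pow, div_le_iff₀ (by positivity), ← g1]
        nlinarith [sq_nonneg ((z 0 - x₁ 0) * p.2 - (z 1 - x₁ 1) * p.1)]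
      · field_simp
        rw [hp1, hp2]
        linear_combination g2 - g1
  · rintro ⟨⟨a, a'⟩, ⟨⟨u0, u1⟩, hu, hG⟩⟩
    simp only at *
    have hk : 0 < p.1 ^ 2 + p.2 ^ 2 - (sg a * r₂ - r₁) ^ 2 := by linarith [sg_bd a h₁ h₂]
    have hl : 0 < q.1 ^ 2 + q.2 ^ 2 - (sg a' * r₃ - r₁) ^ 2 := by linarith [sg_bd a' h₁ h₃]
    by_cases hm : u0 * p.1 + u1 * p.2 + (sg a * r₂ - r₁) = 0
    · have hm' : u0 * q.1 + u1 * q.2 + (sg a' * r₃ - r₁) = 0 := by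
        rw [hm, mul_zero] at hG
        exact (mul_eq_zero.mp hG.symm).resolve_left hk.ne'
      refine existsUnique_of_exists_of_unique ?_ ?_
      · obtain ⟨L, hL, hLn⟩ := exists_line (u0, u1) hu (u0 * x₁ 0 + u1 * x₁ 1 + r₁)
        refine ⟨Sum.inr (Sum.inl ⟨L, hL, ?_⟩), hLn, hm, hm'⟩
        intro i
        fin_cases i
        · refine (lineTangent_iff hLn hu x₁ h₁.le).mpr ?_
          simp only
          ring
        · refine (lineTangent_iff hLn hu x₂ h₂.le).mpr ?_
          simp only
          have : u0 * x₁ 0 + u1 * x₁ 1 + r₁ - (u0 * x₂ 0 + u1 * x₂ 1) = sg a * r₂ := by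
            rw [hp1, hp2] at hm
            linarith
          rw [this, mul_pow, sg_sq, one_mul]
        · refine (lineTangent_iff hLn hu x₃ h₃.le).mpr ?_
          simp only
          have : u0 * x₁ 0 + u1 * x₁ 1 + r₁ - (u0 * x₃ 0 + u1 * x₃ 1) = sg a' * r₃ := by
            rw [hq1, hq2] at hm'
            linarith
          rw [this, mul_pow, sg_sq, one_mul]
      · rintro (⟨⟨y, s⟩, hs, hT⟩ | ⟨L, hL, hT⟩ | ⟨z, hz⟩) (⟨⟨y', s'⟩, hs', hT'⟩ | ⟨L', hL', hT'⟩ | ⟨z', hz'⟩) hA hB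
        any_goals exact hA.elim
        any_goals exact hB.elim
        any_goals
          obtain ⟨t, ht, e1, e2, e3, e4⟩ := hA
          simp only [hm, mul_zero] at e3
          exact absurd e3 hk.ne
        · obtain ⟨t, ht, e1, e2, e3, e4⟩ := hB
          simp only [hm, mul_zero] at e3
          exact absurd e3 hk.ne
        · have : L = L' := by
            ext z
            rw [hA.1 z, hB.1 z]
          subst this
          rfl
    · obtain ⟨m, hmd⟩ : ∃ m, m = u0 * p.1 + u1 * p.2 + (sg a * r₂ - r₁) := ⟨_, rfl⟩
      obtain ⟨n, hnd⟩ : ∃ n, n = u0 * q.1 + u1 * q.2 + (sg a' * r₃ - r₁) := ⟨_, rfl⟩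
      rw [← hmd] at hm
      obtain ⟨k, hkd⟩ : ∃ k, k = p.1 ^ 2 + p.2 ^ 2 - (sg a * r₂ - r₁) ^ 2 := ⟨_, rfl⟩
      obtain ⟨l, hld⟩ : ∃ l, l = q.1 ^ 2 + q.2 ^ 2 - (sg a' * r₃ - r₁) ^ 2 := ⟨_, rfl⟩
      rw [← hkd] at hk
      rw [← hld] at hl
      rw [← hmd, ← hnd, ← hkd, ← hld] at hG
      obtain ⟨t, ht⟩ : ∃ t, t = k / (2 * m) - r₁ := ⟨_, rfl⟩
      have k2 : 2 * (t + r₁) * m = k := by rw [ht]; field_simp; ring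
      have k3 : 2 * (t + r₁) * n = l := by
        apply mul_left_cancel₀ hk.ne'
        linear_combination -2 * (t + r₁) * hG + l * k2
      have saa := sg_sq a
      have saa' := sg_sq a'
      have ht0 : t ≠ 0 := by
        intro h0
        rw [h0] at k2
        refine no_common h₁ h₂ hp (w := u0 * p.1 + u1 * p.2) ?_ ?_
        · nlinarith [sq_nonneg (u0 * p.2 - u1 * p.1)]
        · rw [hmd, hkd] at k2
          linear_combination -k2 + r₂ ^ 2 * saa
      refine existsUnique_of_exists_of_unique ?_ ?_
      · refine ⟨Sum.inl ⟨(!₂[x₁ 0 + (t + r₁) * u0, x₁ 1 + (t + r₁) * u1], |t|), abs_pos.mpr ht0, ?_⟩,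
          t, rfl, by simp, by simp, ?_, ?_⟩
        · obtain ⟨b, hb⟩ : ∃ b, |t| = sg b * t := exists_sg (sq_abs t)
          have sbb := sg_sq b
          intro i
          simp only
          fin_cases i
          · refine (circleTangent_iff _ x₁ (abs_pos.mpr ht0) h₁).mpr ⟨b, ?_⟩
            rw [hb]
            simp
            linear_combination (t + r₁) ^ 2 * hu - (t + r₁) ^ 2 * sbb
          · obtain ⟨c, hc⟩ := exists_sg_mul b a
            refine (circleTangent_iff _ x₂ (abs_pos.mpr ht0) h₂).mpr ⟨c, ?_⟩
            rw [hb, hc]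
            simp
            rw [hmd, hkd, hp1, hp2] at k2
            linear_combination (t + r₁) ^ 2 * hu - (t + sg a * r₂) ^ 2 * sbb - k2
          · obtain ⟨c, hc⟩ := exists_sg_mul b a'
            refine (circleTangent_iff _ x₃ (abs_pos.mpr ht0) h₃).mpr ⟨c, ?_⟩
            rw [hb, hc]
            simp
            rw [hnd, hld, hq1, hq2] at k3
            linear_combination (t + r₁) ^ 2 * hu - (t + sg a' * r₃) ^ 2 * sbb - k3
        · simp only
          rw [← hmd, ← hkd, k2]
        · simp only
          rw [← hnd, ← hld, k3]
      · rintro (⟨⟨y, s⟩, hs, hT⟩ | ⟨L, hL, hT⟩ | ⟨z, hz⟩) (⟨⟨y', s'⟩, hs', hT'⟩ | ⟨L', hL', hT'⟩ | ⟨z', hz'⟩) hA hB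
        any_goals exact hA.elim
        any_goals exact hB.elim
        rotate_left
        · exact absurd (hmd.trans hB.2.1) hm
        · exact absurd (hmd.trans hA.2.1) hm
        · exact absurd (hmd.trans hA.2.1) hm
        obtain ⟨t₁, ht₁, e1, e2, e3, e4⟩ := hA
        obtain ⟨t₂, ht₂, f1, f2, f3, f4⟩ := hB
        simp only at *
        have htt : t₁ = t₂ := by
          rw [← hmd] at e3 f3
          have := mul_right_cancel₀ hm (e3.trans f3.symm)
          linarith
        subst htt
        have hss : s = s' := by rw [← ht₁, ← ht₂]
        have hyy : y = y' := by
          ext i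
          fin_cases i
          · exact e1.trans f1.symm
          · exact e2.trans f2.symm
        subst hss hyy
        rfl

/-- Three pairwise externally disjoint circles admit exactly 8 Apollonius solutions. -/
theorem apollonius_disjoint_eight_solutions (x₁ x₂ x₃ : Pl) (r₁ r₂ r₃ : ℝ)
    (h₁ : 0 < r₁) (h₂ : 0 < r₂) (h₃ : 0 < r₃)
    (h₁₂ : ‖x₁ - x₂‖ > r₁ + r₂) (h₁₃ : ‖x₁ - x₃‖ > r₁ + r₃)
    (h₂₃ : ‖x₂ - x₃‖ > r₂ + r₃) :
    Nat.card (ApolloniusSolutions ![x₁, x₂, x₃] ![r₁, r₂, r₃]) = 8 := by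

  have hp := far h₁ h₂ h₁₂
  have hq := far h₁ h₃ h₁₃
  have hpq := far h₂ h₃ h₂₃
  rw [main_aux x₁ x₂ x₃ r₁ r₂ r₃ h₁ h₂ h₃ (x₂ 0 - x₁ 0, x₂ 1 - x₁ 1) (x₃ 0 - x₁ 0, x₃ 1 - x₁ 1)
    rfl rfl rfl rfl hp hq]
  have hc : ∀ e : Bool × Bool, Nat.card {u // Good (x₂ 0 - x₁ 0, x₂ 1 - x₁ 1)
      (x₃ 0 - x₁ 0, x₃ 1 - x₁ 1) (sg e.1 * r₂ - r₁) (sg e.2 * r₃ - r₁) u} = 2 := by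
    intro e
    apply card_good
    · exact (sg_bd e.1 h₁ h₂).trans_lt hp
    · exact (sg_bd e.2 h₁ h₃).trans_lt hq
    · have := sg_bd2 e.1 e.2 h₂ h₃
      simp only
      nlinarith
  have : ∀ e : Bool × Bool, Finite {u // Good (x₂ 0 - x₁ 0, x₂ 1 - x₁ 1)
      (x₃ 0 - x₁ 0, x₃ 1 - x₁ 1) (sg e.1 * r₂ - r₁) (sg e.2 * r₃ - r₁) u} := fun e =>
    Nat.finite_of_card_ne_zero (by rw [hc e]; norm_num)
  rw [Nat.card_sigma]
  simp only [hc]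
  simp
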